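/- Let G be a stratified group, Σ ⊂ G a p-dimensional Lipschitz submanifold, and x ∈ Σ \ Σ_*. Then there exist a graded basis X_1,…,X_n of 𝒢 and a basis v_1,…,v_p of T_xΣ such that, writing v_j = Σ_{i=1}^n C_{ij} X_i(x), the n×p matrix C has the following block-echelon form: there are integers 0 ≤ α_k ≤ n_k with α_1+…+α_ι = p such that, grouping the rows into layers of sizes n_1,…,n_ι and the columns into groups of sizes α_1,…,α_ι, the k-th column group has the identity matrix Id_{α_k} in the first α_k rows of the k-th row layer; all entries of the k-th column group in row layers with index < k are zero, all entries in the rows of row layer k below the identity block are zero for column groups with index ≤ k, and entries of column groups with index > k in row layer k below the first α_k rows may be arbitrary. Moreover d_Σ(x) = Σ_{k=1}^ι k α_k. -/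

import Mathlib

open Set Filter Function Module MeasureTheory
open scoped ENNReal Topology NNReal

noncomputable section

/-- A stratified (Carnot) group of step `ι`, identified with `ℝⁿ` through exponential
coordinates of the first kind adapted to a graded basis.  The coordinate `i` has degree
`deg i` (the index of the layer it belongs to); coordinates are ordered by layer.
The group operation is smooth, has the origin as identity, `-x` as inverse of `x`
(exponential coordinates of the first kind), satisfies the Baker-Campbell-Hausdorff
grading structure, is compatible with the dilations
`δ_r x = (r^{deg i} * x i)_i`, and the layers are bracket generating:
`V_{j+1} = [V_1, V_j]`. -/
structure StratifiedGroup where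
  n : ℕ
  ι : ℕ
  ι_pos : 0 < ι
  deg : Fin n → ℕ
  deg_pos : ∀ i, 1 ≤ deg i
  deg_le : ∀ i, deg i ≤ ι
  deg_surj : ∀ j, 1 ≤ j → j ≤ ι → ∃ i, deg i = j
  deg_mono : Monotone deg
  mul : (Fin n → ℝ) → (Fin n → ℝ) → (Fin n → ℝ)
  mul_assoc' : ∀ x y z, mul (mul x y) z = mul x (mul y z)
  zero_mul' : ∀ x, mul 0 x = x
  mul_zero' : ∀ x, mul x 0 = x
  mul_neg' : ∀ x, mul x (-x) = 0
  mul_smooth : ContDiff ℝ (⊤ : ℕ∞) fun q : (Fin n → ℝ) × (Fin n → ℝ) => mul q.1 q.2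
  mul_graded : ∀ x x' y y' : Fin n → ℝ, ∀ i : Fin n,
    (∀ k, deg k < deg i → x k = x' k ∧ y k = y' k) →
    mul x y i - x i - y i = mul x' y' i - x' i - y' i
  dil_mul : ∀ r : ℝ, 0 < r → ∀ x y : Fin n → ℝ, ∀ i : Fin n,
    mul (fun k => r ^ deg k * x k) (fun k => r ^ deg k * y k) i = r ^ deg i * mul x y i
  bracket_gen : ∀ j, 1 ≤ j → j < ι → ∀ w : Fin n → ℝ,
    (∀ i, deg i ≠ j + 1 → w i = 0) →
    w ∈ Submodule.span ℝ { z : Fin n → ℝ | ∃ u v : Fin n → ℝ,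
      (∀ i, deg i ≠ 1 → u i = 0) ∧ (∀ i, deg i ≠ j → v i = 0) ∧
      z = fun i => if deg i = j + 1 then mul u v i - u i - v i else 0 }

namespace StratifiedGroup

/-- The underlying space of the group, `ℝⁿ` in graded coordinates. -/
abbrev Pt (G : StratifiedGroup) : Type := Fin G.n → ℝ

variable (G : StratifiedGroup)

/-- The intrinsic dilation `δ_r`. -/
def dil (r : ℝ) (x : G.Pt) : G.Pt := fun i => r ^ G.deg i * x i

/-- Left translation `l_x`. -/
def lTrans (x : G.Pt) : G.Pt → G.Pt := fun y => G.mul x y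

/-- The left translate `x⁻¹ · S` of a set `S` (the inverse of `x` is `-x`). -/
def shift (x : G.Pt) (S : Set G.Pt) : Set G.Pt := (fun y => G.mul (-x) y) '' S

/-- `n_j`: the dimension of the `j`-th layer. -/
def nLayer (j : ℕ) : ℕ := (Finset.univ.filter fun i : Fin G.n => G.deg i = j).card

/-- `m_j = n_1 + ⋯ + n_j`. -/
def mVal (j : ℕ) : ℕ := (Finset.univ.filter fun i : Fin G.n => G.deg i ≤ j).card

/-- Projection onto the `j`-th layer of coordinates. -/
def layerProj (j : ℕ) (x : G.Pt) : G.Pt := fun i => if G.deg i = j then x i else 0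

/-- `D(p)`, the maximal dimension: the maximum of `d(α) = d_{α_1} + ⋯ + d_{α_p}` over
multi-indices `1 ≤ α_1 < ⋯ < α_p ≤ n`. -/
def maxDim (p : ℕ) : ℕ :=
  sSup {D : ℕ | ∃ α : Finset (Fin G.n), α.card = p ∧ D = ∑ i ∈ α, G.deg i}

/-- `ℓ(p)`: the largest `l ∈ [1, ι]` with `p ≤ n_l + ⋯ + n_ι`. -/
def ellVal (p : ℕ) : ℕ :=
  sSup {l : ℕ | 1 ≤ l ∧ l ≤ G.ι ∧ p ≤ ∑ j ∈ Finset.Icc l G.ι, G.nLayer j}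

/-- `r_p = p - (n_{ℓ(p)+1} + ⋯ + n_ι)`. -/
def rVal (p : ℕ) : ℕ := p - ∑ j ∈ Finset.Icc (G.ellVal p + 1) G.ι, G.nLayer j

/-- The tangent space `T_0(x⁻¹ · S)` of the translated set at the identity:
the span of the tangent cone at `0` of `x⁻¹ · S`. -/
def tangentAt (S : Set G.Pt) (x : G.Pt) : Submodule ℝ G.Pt :=
  Submodule.span ℝ (tangentConeAt ℝ (G.shift x S) 0)

/-- The pointwise degree `d_Σ(x)` of a `p`-dimensional set `Σ = S` at `x`: the maximal
`d(α)` over multi-indices `α` such that the coefficient `c_α` of the tangent `p`-vector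
is nonzero; equivalently, such that the projection of `T_0(x⁻¹·S)` onto the coordinates
in `α` is injective. -/
def pointDeg (p : ℕ) (S : Set G.Pt) (x : G.Pt) : ℕ :=
  sSup {D : ℕ | ∃ α : Finset (Fin G.n), α.card = p ∧
    (∀ v ∈ G.tangentAt S x, (∀ i ∈ α, v i = 0) → v = 0) ∧ D = ∑ i ∈ α, G.deg i}

/-- The generalized characteristic set `Σ_c`: points of degree less than `D(p)`. -/
def charSet (p : ℕ) (S : Set G.Pt) : Set G.Pt := {x ∈ S | G.pointDeg p S x < G.maxDim p}

end StratifiedGroup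

/-- A homogeneous distance on a stratified group: a continuous (for the Euclidean
topology) distance, left invariant and `1`-homogeneous with respect to dilations. -/
structure HomDistOn (G : StratifiedGroup) where
  d : G.Pt → G.Pt → ℝ
  symm : ∀ x y, d x y = d y x
  triangle : ∀ x y z, d x z ≤ d x y + d y z
  eq_zero_iff : ∀ x y, d x y = 0 ↔ x = y
  continuous : Continuous fun q : G.Pt × G.Pt => d q.1 q.2
  left_invariant : ∀ x y z, d (G.mul z x) (G.mul z y) = d x y
  homogeneous : ∀ r : ℝ, 0 < r → ∀ x y, d (G.dil r x) (G.dil r y) = r * d x y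

/-- The open ball of a homogeneous distance. -/
def HomDistOn.ball {G : StratifiedGroup} (D : HomDistOn G) (x : G.Pt) (r : ℝ) : Set G.Pt :=
  {y | D.d x y < r}

/-- Euclidean norm on `ℝⁿ` (the graded coordinates are orthonormal). -/
def eNorm {n : ℕ} (x : Fin n → ℝ) : ℝ := Real.sqrt (∑ i, x i ^ 2)

/-- Euclidean scalar product. -/
def eDot {n : ℕ} (x y : Fin n → ℝ) : ℝ := ∑ i, x i * y i

/-- Euclidean distance. -/
def euclDist {n : ℕ} (x y : Fin n → ℝ) : ℝ := eNorm (x - y)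

/-- Euclidean open ball `B_E(x, r)`. -/
def eBall {n : ℕ} (x : Fin n → ℝ) (r : ℝ) : Set (Fin n → ℝ) := {y | eNorm (y - x) < r}

/-- Diameter of a set with respect to a distance function. -/
def sdiam {α : Type*} (dist : α → α → ℝ) (A : Set α) : ℝ≥0∞ :=
  ⨆ x ∈ A, ⨆ y ∈ A, ENNReal.ofReal (dist x y)

/-- The `q`-dimensional Hausdorff measure built from the distance `dist`. -/
def hMeas {α : Type*} (dist : α → α → ℝ) (q : ℝ) (A : Set α) : ℝ≥0∞ :=
  ⨆ (δ : ℝ≥0∞) (_ : 0 < δ),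
    ⨅ (t : ℕ → Set α) (_ : A ⊆ ⋃ i, t i) (_ : ∀ i, sdiam dist (t i) ≤ δ),
      ∑' i, sdiam dist (t i) ^ q

/-- The Hausdorff dimension built from the distance `dist`:
`inf {q ≥ 0 : H^q(A) = 0}` (`∞` if there is no such exponent). -/
def hDim {α : Type*} (dist : α → α → ℝ) (A : Set α) : ℝ≥0∞ :=
  sInf {q : ℝ≥0∞ | ∃ q' : ℝ, 0 ≤ q' ∧ q = ENNReal.ofReal q' ∧ hMeas dist q' A = 0}

/-- Hausdorff distance between two sets, with respect to a distance function. -/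
def hdDist {α : Type*} (dist : α → α → ℝ) (A B : Set α) : ℝ≥0∞ :=
  max (⨆ a ∈ A, ⨅ b ∈ B, ENNReal.ofReal (dist a b))
      (⨆ b ∈ B, ⨅ a ∈ A, ENNReal.ofReal (dist a b))

/-- `(V, φ)` is a `C¹` chart (local parametrization) of the `p`-dimensional submanifold
`S ⊆ ℝⁿ`: `φ` is a `C¹` injective immersion on the open set `V`, and it is an open map
onto (a relatively open piece of) `S`. -/
def IsC1Chart (n p : ℕ) (S : Set (Fin n → ℝ)) (V : Set (Fin p → ℝ))
    (φ : (Fin p → ℝ) → Fin n → ℝ) : Prop :=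
  IsOpen V ∧ ContDiffOn ℝ 1 φ V ∧ Set.InjOn φ V ∧
  (∀ t ∈ V, Function.Injective (fderivWithin ℝ φ V t)) ∧
  (∀ W, W ⊆ V → IsOpen W → ∃ O : Set (Fin n → ℝ), IsOpen O ∧ φ '' W = S ∩ O)

/-- `S ⊆ ℝⁿ` is a `p`-dimensional `C¹` submanifold. -/
def IsC1Submanifold (n p : ℕ) (S : Set (Fin n → ℝ)) : Prop :=
  ∀ x ∈ S, ∃ V φ, IsC1Chart n p S V φ ∧ x ∈ φ '' V

/-- A `C^{1,λ}` chart: a `C¹` chart whose differential is locally `λ`-Hölder continuous. -/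
def IsHolderChart (n p : ℕ) (la : ℝ) (S : Set (Fin n → ℝ)) (V : Set (Fin p → ℝ))
    (φ : (Fin p → ℝ) → Fin n → ℝ) : Prop :=
  IsC1Chart n p S V φ ∧
  ∀ K : Set (Fin p → ℝ), IsCompact K → K ⊆ V → ∃ C : ℝ, ∀ s ∈ K, ∀ t ∈ K,
    ‖fderivWithin ℝ φ V s - fderivWithin ℝ φ V t‖ ≤ C * ‖s - t‖ ^ la

/-- `S ⊆ ℝⁿ` is a `p`-dimensional submanifold of class `C^{1,λ}`. -/
def IsC1HolderSubmanifold (n p : ℕ) (la : ℝ) (S : Set (Fin n → ℝ)) : Prop :=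
  ∀ x ∈ S, ∃ V φ, IsHolderChart n p la S V φ ∧ x ∈ φ '' V

/-- `S ⊆ ℝⁿ` is a `p`-dimensional Lipschitz submanifold: locally the graph of a
Euclidean Lipschitz map from a `p`-dimensional subspace to a complement. -/
def IsLipschitzSubmanifold (n p : ℕ) (S : Set (Fin n → ℝ)) : Prop :=
  ∀ x ∈ S, ∃ (U : Set (Fin n → ℝ)) (W V' : Submodule ℝ (Fin n → ℝ))
    (f : W → (Fin n → ℝ)) (A : Set W),
    IsOpen U ∧ x ∈ U ∧ IsCompl W V' ∧ Module.finrank ℝ W = p ∧ IsOpen A ∧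
    (∃ K : ℝ≥0, LipschitzWith K f) ∧ (∀ w, f w ∈ V') ∧
    S ∩ U = (fun w : W => (w : Fin n → ℝ) + f w) '' A

/-- The singular set `Σ_*` of a `p`-dimensional set: the points where the Euclidean
tangent cone is not a `p`-dimensional subspace. -/
def singularSet (n p : ℕ) (S : Set (Fin n → ℝ)) : Set (Fin n → ℝ) :=
  {x ∈ S | ¬ ∃ T : Submodule ℝ (Fin n → ℝ), Module.finrank ℝ T = p ∧
    tangentConeAt ℝ S x = (T : Set (Fin n → ℝ))}

/-- The subspace of `ℝⁿ` of vectors supported on the coordinates in `s`. -/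
def coordSubmodule (n : ℕ) (s : Set (Fin n)) : Submodule ℝ (Fin n → ℝ) where
  carrier := {v | ∀ i, i ∉ s → v i = 0}
  add_mem' := by
    intro a b ha hb i hi
    simp [Pi.add_apply, ha i hi, hb i hi]
  zero_mem' := by intro i _; rfl
  smul_mem' := by
    intro c a ha i hi
    simp [Pi.smul_apply, ha i hi]

/-- The Plücker coordinates (with respect to the standard basis of `Λ_p ℝⁿ`) of the
`p`-vector `v_1 ∧ ⋯ ∧ v_p`: the coordinate indexed by the multi-index `α` (a subset of
cardinality `p`, enumerated increasingly) is the determinant of the corresponding minor. -/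
def pluckerC {n p : ℕ} (v : Fin p → Fin n → ℝ) (α : Finset (Fin n)) : ℝ :=
  if h : α.card = p then
    Matrix.det (Matrix.of fun a b : Fin p => v b (α.orderIsoOfFin h a).1)
  else 0

/-- The projection `π_D` of degree `D` of a `p`-vector given in coordinates: it keeps
only the coefficients `c_α` with `d(α) = D`. -/
def projDegC {n : ℕ} (deg : Fin n → ℕ) (D : ℕ) (c : Finset (Fin n) → ℝ) :
    Finset (Fin n) → ℝ :=
  fun α => if (∑ i ∈ α, deg i) = D then c α else 0

/-- The norm of a `p`-vector in coordinates (the standard basis of `Λ_p ℝⁿ` being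
orthonormal for the graded metric). -/
def pvecNorm {n : ℕ} (c : Finset (Fin n) → ℝ) : ℝ :=
  Real.sqrt (∑ α : Finset (Fin n), (c α) ^ 2)

/-- Coefficients of the wedge product `u ∧ c` of a vector with a `p`-vector. -/
def wedgeVec {n : ℕ} (c : Finset (Fin n) → ℝ) (u : Fin n → ℝ) (β : Finset (Fin n)) : ℝ :=
  ∑ i ∈ β, (-1 : ℝ) ^ (β.filter fun j => j < i).card * u i * c (β.erase i)

/-- The subspace associated with a simple `p`-vector `c`: vectors whose wedge with `c`
vanishes. -/
def pvecSpan {n : ℕ} (p : ℕ) (c : Finset (Fin n) → ℝ) : Set (Fin n → ℝ) :=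
  {u | ∀ β : Finset (Fin n), β.card = p + 1 → wedgeVec c u β = 0}

/-- A Riemannian metric on `ℝⁿ`: a continuous family of inner products. -/
structure RiemannMetric (n : ℕ) where
  g : (Fin n → ℝ) → (Fin n → ℝ) → (Fin n → ℝ) → ℝ
  symm : ∀ x u v, g x u v = g x v u
  lin : ∀ x v, IsLinearMap ℝ fun u => g x u v
  posdef : ∀ x u, u ≠ 0 → 0 < g x u u
  cont : Continuous fun q : (Fin n → ℝ) × (Fin n → ℝ) × (Fin n → ℝ) => g q.1 q.2.1 q.2.2

/-- The Gram determinant of the partial derivatives of a chart `φ` at `t`, with respect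
to a Riemannian metric: the square of the Riemannian surface density. -/
def gramDet {n p : ℕ} (gt : RiemannMetric n) (φ : (Fin p → ℝ) → Fin n → ℝ)
    (V : Set (Fin p → ℝ)) (t : Fin p → ℝ) : ℝ :=
  Matrix.det (Matrix.of fun j k : Fin p =>
    gt.g (φ t) (fderivWithin ℝ φ V t (Pi.single j 1)) (fderivWithin ℝ φ V t (Pi.single k 1)))

/-- The tangent `p`-tuple of a chart `φ` at `t₀`, left translated to the identity:
`(dl_{φ(t₀)⁻¹})(∂_{t_j} φ(t₀))`. -/
def tangentBasisT (G : StratifiedGroup) {p : ℕ} (V : Set (Fin p → ℝ))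
    (φ : (Fin p → ℝ) → G.Pt) (t0 : Fin p → ℝ) : Fin p → G.Pt :=
  fun j => fderiv ℝ (G.lTrans (-(φ t0))) (φ t0) (fderivWithin ℝ φ V t0 (Pi.single j 1))

/-- The density of the intrinsic measure in a chart:
`‖(∂_{t_1} φ ∧ ⋯ ∧ ∂_{t_p} φ)_{D, φ(t)}‖`. -/
def intIntegrand (G : StratifiedGroup) {p : ℕ} (D : ℕ) (V : Set (Fin p → ℝ))
    (φ : (Fin p → ℝ) → G.Pt) (t : Fin p → ℝ) : ℝ :=
  pvecNorm (projDegC G.deg D (pluckerC (tangentBasisT G V φ t)))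

/-- Cumulative sums `μ_k = α_1 + ⋯ + α_k`. -/
def cumsum (α : ℕ → ℕ) (k : ℕ) : ℕ := ∑ l ∈ Finset.Icc 1 k, α l

/-- The coefficient matrix `C` of the vectors `v_j` of `T_x Σ` with respect to the graded
basis `X_i` determined by the orthogonal layer-preserving matrix `U`:
`v_j = ∑_i C_{ij} X_i(x)`, i.e. `C_{ij} = ⟨U_{·i}, dl_{x⁻¹}(v_j)⟩`. -/
def Cmat (G : StratifiedGroup) {p : ℕ} (U : Matrix (Fin G.n) (Fin G.n) ℝ)
    (v : Fin p → G.Pt) (x : G.Pt) (i : Fin G.n) (j : Fin p) : ℝ :=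
  ∑ k, U k i * fderiv ℝ (G.lTrans (-x)) x (v j) k

/-- The intrinsic integers `α_k(x)` attached to a point of a submanifold:
`α_k = dim F_k - dim F_{k+1}` where `F_k` is the subspace of the (translated) tangent
space of vectors supported in the layers of degree `≥ k`. -/
def alphaOf (G : StratifiedGroup) (p : ℕ) (S : Set G.Pt) (x : G.Pt) (k : ℕ) : ℕ :=
  Module.finrank ℝ ↥(G.tangentAt S x ⊓ coordSubmodule G.n {i | k ≤ G.deg i}) -
  Module.finrank ℝ ↥(G.tangentAt S x ⊓ coordSubmodule G.n {i | k + 1 ≤ G.deg i})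

/-- The part `Σ_{c,A}` of the generalized characteristic set. -/
def charSetA (G : StratifiedGroup) (p : ℕ) (S : Set G.Pt) : Set G.Pt :=
  {x ∈ G.charSet p S | ∃ j, G.ellVal p + 1 ≤ j ∧ j ≤ G.ι ∧ alphaOf G p S x j < G.nLayer j}

/-- The part `Σ_{c,B}` of the generalized characteristic set. -/
def charSetB (G : StratifiedGroup) (p : ℕ) (S : Set G.Pt) : Set G.Pt :=
  {x ∈ G.charSet p S | (∀ j, G.ellVal p + 1 ≤ j → j ≤ G.ι → alphaOf G p S x j = G.nLayer j)
    ∧ alphaOf G p S x (G.ellVal p) < G.rVal p}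

/-- The defining property of the threshold `r̄_ε`: for all `r < r̄_ε`, all `x ∈ S`, all
`y ∈ (x⁻¹·S) ∩ B_E(0,r)` and all unit vectors `w ⊥ T_0(x⁻¹·S)`, one has `|⟨y,w⟩| ≤ ε r`. -/
def RbarSpec (G : StratifiedGroup) (S : Set G.Pt) (ε rb : ℝ) : Prop :=
  0 < rb ∧ ∀ r : ℝ, 0 < r → r < rb → ∀ x ∈ S, ∀ y ∈ G.shift x S ∩ eBall 0 r,
    ∀ w : G.Pt, eNorm w = 1 → (∀ v ∈ G.tangentAt S x, eDot v w = 0) → |eDot y w| ≤ ε * r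

/-- `G` is (isomorphic to) the `n`-th Heisenberg group: step 2, horizontal layer of
dimension `2n`, one-dimensional center, nondegenerate bracket on the first layer. -/
def IsHeisenberg (G : StratifiedGroup) (n : ℕ) : Prop :=
  G.ι = 2 ∧ G.n = 2 * n + 1 ∧ G.nLayer 1 = 2 * n ∧ G.nLayer 2 = 1 ∧
  ∀ u : G.Pt, (∀ i, G.deg i ≠ 1 → u i = 0) → u ≠ 0 →
    ∃ v : G.Pt, (∀ i, G.deg i ≠ 1 → v i = 0) ∧
      ∃ i, G.deg i = 2 ∧ G.mul u v i - u i - v i ≠ 0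

end

section LinearAlgebra

variable {n : ℕ}

lemma exists_last_ne_zero {v : Fin n → ℝ} (hv : v ≠ 0) :
    ∃ i, v i ≠ 0 ∧ ∀ k, i < k → v k = 0 := by
  obtain ⟨i₀, hi₀⟩ := Function.ne_iff.mp hv
  obtain ⟨i, hi, hmax⟩ := (Finset.univ.filter fun i => v i ≠ 0).exists_max_image id
    ⟨i₀, by simpa using hi₀⟩
  refine ⟨i, by simpa using hi, fun k hk => ?_⟩
  by_contra hne
  exact absurd (hmax k (by simpa using hne)) (not_le.mpr hk)

/-- The positions of the last nonzero coordinate of the nonzero vectors of `E`. -/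
noncomputable def pivots (E : Submodule ℝ (Fin n → ℝ)) : Finset (Fin n) :=
  {i : Fin n | ∃ v ∈ E, v i ≠ 0 ∧ ∀ k, i < k → v k = 0}.toFinite.toFinset

lemma mem_pivots {E : Submodule ℝ (Fin n → ℝ)} {i : Fin n} :
    i ∈ pivots E ↔ ∃ v ∈ E, v i ≠ 0 ∧ ∀ k, i < k → v k = 0 := by
  simp [pivots]

lemma eq_zero_of_pivots {E : Submodule ℝ (Fin n → ℝ)} {v : Fin n → ℝ} (hv : v ∈ E)
    (h : ∀ i ∈ pivots E, v i = 0) : v = 0 := by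
  by_contra hne
  obtain ⟨i, hi, hlast⟩ := exists_last_ne_zero hne
  exact hi (h i (mem_pivots.mpr ⟨v, hv, hi, hlast⟩))

lemma finrank_le_card_of_coords {E : Submodule ℝ (Fin n → ℝ)} {A : Finset (Fin n)}
    (h : ∀ v ∈ E, (∀ i ∈ A, v i = 0) → v = 0) : finrank ℝ E ≤ A.card := by
  let f : E →ₗ[ℝ] (A → ℝ) :=
    (LinearMap.pi fun i : A => LinearMap.proj (i : Fin n)) ∘ₗ E.subtype
  have hf : Function.Injective f := by
    rw [← LinearMap.ker_eq_bot, LinearMap.ker_eq_bot']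
    intro v hv
    exact Subtype.ext (h v v.2 fun i hi => congrFun hv ⟨i, hi⟩)
  simpa using LinearMap.finrank_le_finrank_of_injective hf

lemma card_pivots (E : Submodule ℝ (Fin n → ℝ)) : (pivots E).card = finrank ℝ E := by
  refine le_antisymm ?_ (finrank_le_card_of_coords fun v hv => eq_zero_of_pivots hv)
  choose v hvE hv hlast using fun i : pivots E => mem_pivots.mp i.2
  have hli : LinearIndependent ℝ fun i => (⟨v i, hvE i⟩ : E) := by
    rw [Fintype.linearIndependent_iff]
    intro g hg
    by_contra! hne
    obtain ⟨i₀, hi₀⟩ := hne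
    obtain ⟨i, hi, hmax⟩ := (Finset.univ.filter fun i => g i ≠ 0).exists_max_image id
      ⟨i₀, by simpa using hi₀⟩
    have hsum : ∑ j, g j * v j i = 0 := by
      have := congrFun (congrArg Subtype.val hg) i
      simpa using this
    rw [Finset.sum_eq_single i] at hsum
    · rcases mul_eq_zero.mp hsum with h | h
      · simp [h] at hi
      · exact hv i h
    · intro j _ hji
      by_cases hj : g j = 0
      · simp [hj]
      · have hle : j ≤ i := hmax j (by simpa using hj)
        rw [hlast j i (lt_of_le_of_ne hle (Subtype.coe_injective.ne hji)), mul_zero]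
    · simp
  simpa using hli.fintype_card_le_finrank

/-- Vectors of `E` supported in degree at most `c`. -/
def supportedBelow (deg : Fin n → ℕ) (c : ℕ) (E : Submodule ℝ (Fin n → ℝ)) :
    Submodule ℝ (Fin n → ℝ) :=
  E ⊓ coordSubmodule n {i | deg i ≤ c}

lemma mem_supportedBelow {deg : Fin n → ℕ} {c : ℕ} {E : Submodule ℝ (Fin n → ℝ)}
    {v : Fin n → ℝ} : v ∈ supportedBelow deg c E ↔ v ∈ E ∧ ∀ i, c < deg i → v i = 0 := by
  simp [supportedBelow, coordSubmodule]

/-- Restriction of a vector to the coordinates of degree `c`. -/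
def degreeProj (deg : Fin n → ℕ) (c : ℕ) : (Fin n → ℝ) →ₗ[ℝ] (Fin n → ℝ) :=
  LinearMap.pi fun i => if deg i = c then LinearMap.proj i else 0

lemma degreeProj_apply (deg : Fin n → ℕ) (c : ℕ) (v : Fin n → ℝ) (i : Fin n) :
    degreeProj deg c v i = if deg i = c then v i else 0 := by
  simp only [degreeProj, LinearMap.pi_apply]
  split_ifs <;> rfl

variable {deg : Fin n → ℕ}

lemma pivots_supportedBelow (hmono : Monotone deg) (c : ℕ) (E : Submodule ℝ (Fin n → ℝ)) :
    pivots (supportedBelow deg c E) = (pivots E).filter fun i => deg i ≤ c := by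
  ext i
  simp only [mem_pivots, Finset.mem_filter, mem_supportedBelow]
  constructor
  · rintro ⟨v, ⟨hv, hs⟩, hi, hlast⟩
    exact ⟨⟨v, hv, hi, hlast⟩, not_lt.mp fun h => hi (hs i h)⟩
  · rintro ⟨⟨v, hv, hi, hlast⟩, hc⟩
    refine ⟨v, ⟨hv, fun k hk => hlast k ?_⟩, hi, hlast⟩
    by_contra hle
    have := hmono (not_lt.mp hle)
    omega

lemma pivots_map_degreeProj (hmono : Monotone deg) (c : ℕ) (E : Submodule ℝ (Fin n → ℝ)) :
    pivots ((supportedBelow deg c E).map (degreeProj deg c)) =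
      (pivots E).filter fun i => deg i = c := by
  ext i
  simp only [mem_pivots, Finset.mem_filter, Submodule.mem_map]
  constructor
  · rintro ⟨_, ⟨t, ht, rfl⟩, hi, hlast⟩
    rw [mem_supportedBelow] at ht
    have hc : deg i = c := by
      by_contra h
      simp [degreeProj_apply, h] at hi
    refine ⟨⟨t, ht.1, by simpa [degreeProj_apply, hc] using hi, fun k hk => ?_⟩, hc⟩
    rcases (hmono hk.le).eq_or_lt with h | h
    · simpa [degreeProj_apply, ← h, hc] using hlast k hk
    · exact ht.2 k (hc ▸ h)
  · rintro ⟨⟨v, hv, hi, hlast⟩, hc⟩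
    refine ⟨_, ⟨v, mem_supportedBelow.mpr ⟨hv, fun k hk => hlast k ?_⟩, rfl⟩, ?_, ?_⟩
    · by_contra hle
      have := hmono (not_lt.mp hle)
      omega
    · simpa [degreeProj_apply, hc] using hi
    · intro k hk
      simp [degreeProj_apply, hlast k hk]

lemma sum_deg_eq_sum_card {N : ℕ} (hN : ∀ i, deg i ≤ N) (A : Finset (Fin n)) :
    ∑ i ∈ A, deg i = ∑ c ∈ Finset.range N, (A.filter fun i => c < deg i).card := by
  simp only [Finset.card_filter]
  rw [Finset.sum_comm]
  refine Finset.sum_congr rfl fun i _ => ?_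
  rw [← Finset.card_filter]
  have : (Finset.range N).filter (fun c => c < deg i) = Finset.range (deg i) := by
    ext c
    have := hN i
    simp only [Finset.mem_filter, Finset.mem_range]
    omega
  rw [this, Finset.card_range]

lemma sum_deg_le_sum_pivots (hmono : Monotone deg) (E : Submodule ℝ (Fin n → ℝ))
    {A : Finset (Fin n)} (hcard : A.card = finrank ℝ E)
    (hA : ∀ v ∈ E, (∀ i ∈ A, v i = 0) → v = 0) :
    ∑ i ∈ A, deg i ≤ ∑ i ∈ pivots E, deg i := by
  have hN : ∀ i, deg i ≤ ∑ k, deg k := fun i =>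
    Finset.single_le_sum (f := deg) (fun _ _ => Nat.zero_le _) (Finset.mem_univ i)
  rw [sum_deg_eq_sum_card hN A, sum_deg_eq_sum_card hN (pivots E)]
  refine Finset.sum_le_sum fun c _ => ?_
  have h₁ : ((pivots E).filter fun i => deg i ≤ c).card ≤
      (A.filter fun i => deg i ≤ c).card := by
    rw [← pivots_supportedBelow hmono, card_pivots]
    refine finrank_le_card_of_coords fun v hv hz => ?_
    rw [mem_supportedBelow] at hv
    refine hA v hv.1 fun i hi => ?_
    rcases le_or_gt (deg i) c with h | h
    · exact hz i (Finset.mem_filter.mpr ⟨hi, h⟩)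
    · exact hv.2 i h
  have h₂ := Finset.card_filter_add_card_filter_not (s := A) fun i => deg i ≤ c
  have h₃ := Finset.card_filter_add_card_filter_not (s := pivots E) fun i => deg i ≤ c
  rw [card_pivots, ← hcard] at h₃
  simp only [not_le] at h₂ h₃
  omega

/-- An orthonormal basis of the coordinate subspace `L`, indexed by `L`, whose members with
index outside `A` are orthogonal to the subspace `W`. -/
lemma exists_orthonormal_adapted {L : Set (Fin n)} {A : Finset (Fin n)}
    (hAL : ∀ i ∈ A, i ∈ L) {W : Submodule ℝ (Fin n → ℝ)} (hWL : W ≤ coordSubmodule n L)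
    (hW : finrank ℝ W = A.card) :
    ∃ b : Fin n → Fin n → ℝ, (∀ i ∈ L, ∀ k ∉ L, b i k = 0) ∧
      (∀ i j, ∑ k, b i k * b j k = if i = j then 1 else 0) ∧
      ∀ i ∈ L, i ∉ A → ∀ w ∈ W, ∑ k, b i k * w k = 0 := by
  classical
  let e := (WithLp.linearEquiv 2 ℝ (Fin n → ℝ)).symm
  let W' : Submodule ℝ (EuclideanSpace ℝ (Fin n)) := W.map e.toLinearMap
  have hW' : A.card = finrank ℝ W' := by
    rw [← hW]
    exact (e.submoduleMap W).finrank_eq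
  let b₀ := stdOrthonormalBasis ℝ W'
  let ε : A ≃ Fin (finrank ℝ W') := A.equivFinOfCardEq hW'
  let v : Fin n → EuclideanSpace ℝ (Fin n) := fun i =>
    if h : i ∈ A then (b₀ (ε ⟨i, h⟩) : EuclideanSpace ℝ (Fin n)) else EuclideanSpace.single i 1
  have hzero : ∀ w : W', ∀ k ∉ L, (w : EuclideanSpace ℝ (Fin n)) k = 0 := by
    rintro ⟨_, w, hw, rfl⟩ k hk
    exact hWL hw k hk
  have hon : Orthonormal ℝ (Set.domRestrict {i | i ∈ A ∨ i ∉ L} v) := by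
    rw [orthonormal_iff_ite]
    rintro ⟨i, hi⟩ ⟨j, hj⟩
    simp only [Set.domRestrict_apply, Subtype.mk.injEq, v]
    by_cases hiA : i ∈ A <;> by_cases hjA : j ∈ A
    · rw [dif_pos hiA, dif_pos hjA, ← Submodule.coe_inner,
        orthonormal_iff_ite.mp b₀.orthonormal]
      simp
    · rw [dif_pos hiA, dif_neg hjA, if_neg (by rintro rfl; exact hjA hiA)]
      simp [EuclideanSpace.inner_single_right, hzero _ j (hj.resolve_left hjA)]
    · rw [dif_neg hiA, dif_pos hjA, if_neg (by rintro rfl; exact hiA hjA)]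
      simp [EuclideanSpace.inner_single_left, hzero _ i (hi.resolve_left hiA)]
    · rw [dif_neg hiA, dif_neg hjA]
      simp [EuclideanSpace.inner_single_left]
  obtain ⟨b, hb⟩ := hon.exists_orthonormalBasis_extension_of_card_eq (by simp)
  have hbb := orthonormal_iff_ite.mp b.orthonormal
  refine ⟨fun i k => b i k, fun i hi k hk => ?_, fun i j => ?_, fun i hi hiA w hw => ?_⟩
  · have hne : i ≠ k := by rintro rfl; exact hk hi
    have h := hbb i k
    rw [hb k (Or.inr hk), if_neg hne] at h
    have hkA : k ∉ A := fun h => hk (hAL k h)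
    simpa [v, hkA, EuclideanSpace.inner_single_right] using h
  · rw [← hbb i j, PiLp.inner_apply]
    exact Finset.sum_congr rfl fun k _ => by simp [mul_comm]
  · have hw' : e w ∈ W' := ⟨w, hw, rfl⟩
    have hspan : ∀ u : W', inner ℝ (b i) (u : EuclideanSpace ℝ (Fin n)) = 0 := by
      intro u
      rw [← b₀.sum_repr u, Submodule.coe_sum, inner_sum]
      refine Finset.sum_eq_zero fun m _ => ?_
      have hm : b (ε.symm m : Fin n) = b₀ m := by
        rw [hb _ (Or.inl (ε.symm m).2)]
        simp [v]
      rw [Submodule.coe_smul, inner_smul_right, ← hm, hbb, if_neg, mul_zero]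
      rintro rfl
      exact hiA (ε.symm m).2
    have h := hspan ⟨e w, hw'⟩
    rw [PiLp.inner_apply] at h
    rw [← h]
    exact Finset.sum_congr rfl fun k _ => by simp [e, mul_comm]

/-- The number of indices of `A` of degree at most `c`. -/
def countLE (deg : Fin n → ℕ) (A : Finset (Fin n)) (c : ℕ) : ℕ :=
  (A.filter fun i => deg i ≤ c).card

/-- The number of indices of `A` of degree `c`. -/
def countEQ (deg : Fin n → ℕ) (A : Finset (Fin n)) (c : ℕ) : ℕ :=
  (A.filter fun i => deg i = c).card

lemma countLE_succ (A : Finset (Fin n)) (c : ℕ) :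
    countLE deg A (c + 1) = countLE deg A c + countEQ deg A (c + 1) := by
  unfold countLE countEQ
  rw [← Finset.card_union_of_disjoint]
  · congr 1
    ext i
    simp only [Finset.mem_filter, Finset.mem_union, Nat.le_succ_iff]
    tauto
  · refine Finset.disjoint_filter.mpr fun i _ h => ?_
    omega

lemma countEQ_le_univ (A : Finset (Fin n)) (c : ℕ) :
    countEQ deg A c ≤ countEQ deg Finset.univ c :=
  Finset.card_le_card (Finset.filter_subset_filter _ (Finset.subset_univ _))

lemma mem_iff_lt_card_of_initial {s : Finset (Fin n)} (hs : ∀ i ∈ s, ∀ k ≤ i, k ∈ s)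
    (i : Fin n) : i ∈ s ↔ (i : ℕ) < s.card := by
  constructor
  · intro hi
    have h : Finset.Iic i ⊆ s := fun k hk => hs i hi k (Finset.mem_Iic.mp hk)
    simpa [Nat.succ_le_iff] using Finset.card_le_card h
  · intro hi
    by_contra hne
    have h : s ⊆ Finset.Iio i := fun k hk =>
      Finset.mem_Iio.mpr (not_le.mp fun hle => hne (hs k hk i hle))
    have := Finset.card_le_card h
    rw [Fin.card_Iio] at this
    omega

lemma deg_le_iff_lt_countLE (hmono : Monotone deg) (i : Fin n) (c : ℕ) :
    deg i ≤ c ↔ (i : ℕ) < countLE deg Finset.univ c := by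
  rw [countLE, ← mem_iff_lt_card_of_initial]
  · simp
  · simp only [Finset.mem_filter_univ]
    exact fun i hi k hk => (hmono hk).trans hi

lemma deg_orderEmbOfFin_le_iff (hmono : Monotone deg) {A : Finset (Fin n)} {p : ℕ}
    (hA : A.card = p) (j : Fin p) (c : ℕ) :
    deg (A.orderEmbOfFin hA j) ≤ c ↔ (j : ℕ) < countLE deg A c := by
  have hcard : countLE deg A c =
      (Finset.univ.filter fun j => deg (A.orderEmbOfFin hA j) ≤ c).card := by
    rw [countLE, ← Finset.card_map (A.orderEmbOfFin hA).toEmbedding]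
    congr 1
    ext i
    simp only [Finset.mem_filter, Finset.mem_map, Finset.mem_univ, true_and]
    constructor
    · rintro ⟨hi, hc⟩
      obtain ⟨j, rfl⟩ : i ∈ Set.range (A.orderEmbOfFin hA) := by simpa using hi
      exact ⟨j, hc, rfl⟩
    · rintro ⟨j, hc, rfl⟩
      exact ⟨A.orderEmbOfFin_mem hA j, hc⟩
  rw [hcard, ← mem_iff_lt_card_of_initial]
  · simp
  · simp only [Finset.mem_filter_univ]
    exact fun i hi k hk => (hmono ((A.orderEmbOfFin hA).monotone hk)).trans hi

/-- The index `i` is among the first ones of its layer, as many as `A` has in that layer. -/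
def IsLeading (deg : Fin n → ℕ) (A : Finset (Fin n)) (i : Fin n) : Prop :=
  (i : ℕ) - countLE deg Finset.univ (deg i - 1) < countEQ deg A (deg i)

lemma layer_bounds (hmono : Monotone deg) (hpos : ∀ i, 1 ≤ deg i) (i : Fin n) :
    countLE deg Finset.univ (deg i - 1) ≤ (i : ℕ) ∧
      (i : ℕ) < countLE deg Finset.univ (deg i) := by
  refine ⟨?_, (deg_le_iff_lt_countLE hmono i _).mp le_rfl⟩
  have := (deg_le_iff_lt_countLE hmono i (deg i - 1)).not.mp (by have := hpos i; omega)
  omega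

lemma card_filter_isLeading (hmono : Monotone deg) (hpos : ∀ i, 1 ≤ deg i)
    (A : Finset (Fin n)) {c : ℕ} (hc : 1 ≤ c) {B : Finset (Fin n)}
    (hB : ∀ i, i ∈ B ↔ deg i = c ∧ IsLeading deg A i) : B.card = countEQ deg A c := by
  have h₁ := countLE_succ (deg := deg) Finset.univ (c - 1)
  have h₂ := countEQ_le_univ (deg := deg) A c
  rw [Nat.sub_add_cancel hc] at h₁
  have hle : countLE deg Finset.univ c ≤ n := by
    simpa [countLE] using Finset.card_filter_le (Finset.univ : Finset (Fin n)) (deg · ≤ c)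
  have hmap : B.map Fin.valEmbedding = Finset.Ico (countLE deg Finset.univ (c - 1))
      (countLE deg Finset.univ (c - 1) + countEQ deg A c) := by
    ext k
    simp only [Finset.mem_map, hB, Finset.mem_Ico, Fin.valEmbedding_apply]
    constructor
    · rintro ⟨i, ⟨rfl, hi⟩, rfl⟩
      have := (layer_bounds hmono hpos i).1
      unfold IsLeading at hi
      omega
    · rintro ⟨hk₁, hk₂⟩
      let i : Fin n := ⟨k, by omega⟩
      have hic : deg i = c := by
        have a := (deg_le_iff_lt_countLE hmono i c).mpr (by simp only [i]; omega)
        have b := (deg_le_iff_lt_countLE hmono i (c - 1)).not.mpr (by simp only [i]; omega)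
        omega
      refine ⟨i, ⟨hic, ?_⟩, rfl⟩
      rw [IsLeading, hic]
      simp only [i]
      omega
  rw [← Finset.card_map, hmap, Nat.card_Ico]
  omega

/-- The order-preserving enumeration of the leading indices. -/
lemma exists_enum_isLeading (hmono : Monotone deg) (hpos : ∀ i, 1 ≤ deg i)
    {A : Finset (Fin n)} {p : ℕ} (hA : A.card = p) :
    ∃ π : Fin p → Fin n,
      (∀ j, countLE deg A (deg (π j) - 1) ≤ (j : ℕ) ∧ (j : ℕ) < countLE deg A (deg (π j)) ∧
        (π j : ℕ) - countLE deg Finset.univ (deg (π j) - 1) =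
          (j : ℕ) - countLE deg A (deg (π j) - 1)) ∧
      ∀ i, IsLeading deg A i → ∃ j, π j = i := by
  have key : ∀ j : Fin p, ∃ i : Fin n, countLE deg A (deg i - 1) ≤ (j : ℕ) ∧
      (j : ℕ) < countLE deg A (deg i) ∧ (i : ℕ) - countLE deg Finset.univ (deg i - 1) =
          (j : ℕ) - countLE deg A (deg i - 1) := by
    intro j
    obtain ⟨c, hc⟩ : ∃ c, deg (A.orderEmbOfFin hA j) = c := ⟨_, rfl⟩
    have hc₁ : 1 ≤ c := hc ▸ hpos _
    have hj₁ := (deg_orderEmbOfFin_le_iff hmono hA j c).mp hc.le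
    have hj₂ := (deg_orderEmbOfFin_le_iff hmono hA j (c - 1)).not.mp (by omega)
    have h₁ := countLE_succ (deg := deg) Finset.univ (c - 1)
    have h₂ := countEQ_le_univ (deg := deg) A c
    have h₃ := countLE_succ (deg := deg) A (c - 1)
    rw [Nat.sub_add_cancel hc₁] at h₁ h₃
    have hle : countLE deg Finset.univ c ≤ n := by
      simpa [countLE] using Finset.card_filter_le (Finset.univ : Finset (Fin n)) (deg · ≤ c)
    let i : Fin n := ⟨countLE deg Finset.univ (c - 1) + (j - countLE deg A (c - 1)), by omega⟩
    have hic : deg i = c := by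
      have a := (deg_le_iff_lt_countLE hmono i c).mpr (by simp only [i]; omega)
      have b := (deg_le_iff_lt_countLE hmono i (c - 1)).not.mpr (by simp only [i]; omega)
      omega
    refine ⟨i, ?_⟩
    rw [hic]
    simp only [i]
    omega
  choose π hπ using key
  refine ⟨π, hπ, fun i hi => ?_⟩
  have hbound := layer_bounds hmono hpos i
  have h₃ := countLE_succ (deg := deg) A (deg i - 1)
  rw [Nat.sub_add_cancel (hpos i)] at h₃
  have hle : countLE deg A (deg i) ≤ p :=
    hA ▸ Finset.card_filter_le A (deg · ≤ deg i)
  unfold IsLeading at hi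
  let j : Fin p := ⟨countLE deg A (deg i - 1) + (i - countLE deg Finset.univ (deg i - 1)),
    by omega⟩
  have hmonoLE : Monotone (countLE deg A) := fun a b hab =>
    Finset.card_le_card (Finset.monotone_filter_right A fun k _ hk => le_trans hk hab)
  have hdeg : deg (π j) = deg i := by
    obtain ⟨hj₁, hj₂, -⟩ := hπ j
    have hjv : (j : ℕ) = countLE deg A (deg i - 1) +
      (i - countLE deg Finset.univ (deg i - 1)) := rfl
    rcases lt_trichotomy (deg (π j)) (deg i) with h | h | h
    · have := hmonoLE (show deg (π j) ≤ deg i - 1 by omega)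
      omega
    · exact h
    · have := hmonoLE (show deg i ≤ deg (π j) - 1 by omega)
      omega
  refine ⟨j, Fin.ext ?_⟩
  have hb := (layer_bounds hmono hpos (π j)).1
  have he := (hπ j).2.2
  rw [hdeg] at hb he
  simp only [j] at he hb ⊢
  omega

open Matrix in
/-- A layer-preserving orthogonal change of basis after which the vectors of `E` of top degree
`c` have top-layer component supported in the leading indices. -/
lemma exists_orthogonal_adapted (hmono : Monotone deg) (hpos : ∀ i, 1 ≤ deg i)
    (E : Submodule ℝ (Fin n → ℝ)) :
    ∃ U : Matrix (Fin n) (Fin n) ℝ, Uᵀ * U = 1 ∧ (∀ i k, deg i ≠ deg k → U i k = 0) ∧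
      ∀ t ∈ E, ∀ i, (∀ k, deg i < deg k → (Uᵀ *ᵥ t) k = 0) →
        ¬ IsLeading deg (pivots E) i → (Uᵀ *ᵥ t) i = 0 := by
  classical
  have key : ∀ c, 1 ≤ c → ∃ b : Fin n → Fin n → ℝ,
      (∀ i, deg i = c → ∀ k, deg k ≠ c → b i k = 0) ∧
      (∀ i j, ∑ k, b i k * b j k = if i = j then 1 else 0) ∧
      ∀ i, deg i = c → ¬ IsLeading deg (pivots E) i →
        ∀ w ∈ (supportedBelow deg c E).map (degreeProj deg c), ∑ k, b i k * w k = 0 := by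
    intro c hc
    have hmem : ∀ i, i ∈ (Finset.univ.filter fun i =>
        deg i = c ∧ IsLeading deg (pivots E) i) ↔ deg i = c ∧ IsLeading deg (pivots E) i := by
      simp
    obtain ⟨b, hb₁, hb₂, hb₃⟩ := exists_orthonormal_adapted (L := {i | deg i = c})
      (A := Finset.univ.filter fun i => deg i = c ∧ IsLeading deg (pivots E) i)
      (W := (supportedBelow deg c E).map (degreeProj deg c))
      (fun i hi => ((hmem i).mp hi).1)
      (by
        rintro _ ⟨t, -, rfl⟩ i hi
        exact (degreeProj_apply deg c t i).trans (if_neg hi))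
      (by
        rw [card_filter_isLeading hmono hpos _ hc hmem, ← card_pivots,
          pivots_map_degreeProj hmono, countEQ])
    exact ⟨b, fun i hi k hk => hb₁ i hi k hk, hb₂,
      fun i hi hl => hb₃ i hi fun h => hl ((hmem i).mp h).2⟩
  choose b hb₁ hb₂ hb₃ using key
  let U : Matrix (Fin n) (Fin n) ℝ := Matrix.of fun k i => b (deg i) (hpos i) i k
  have hU : Uᵀ * U = 1 := by
    ext i j
    rw [Matrix.mul_apply, Matrix.one_apply]
    simp only [U, Matrix.transpose_apply, Matrix.of_apply]
    by_cases h : deg i = deg j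
    · rw [← hb₂ (deg i) (hpos i) i j]
      simp only [h]
    · rw [if_neg (by rintro rfl; exact h rfl)]
      refine Finset.sum_eq_zero fun k _ => ?_
      by_cases hk : deg k = deg i
      · rw [hb₁ (deg j) (hpos j) j rfl k (by rwa [hk]), mul_zero]
      · rw [hb₁ (deg i) (hpos i) i rfl k hk, zero_mul]
  have hlayer : ∀ i k, deg i ≠ deg k → U i k = 0 := fun i k h => hb₁ _ (hpos k) k rfl i h
  refine ⟨U, hU, hlayer, fun t ht i hi hl => ?_⟩
  have htU : U *ᵥ (Uᵀ *ᵥ t) = t := by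
    rw [Matrix.mulVec_mulVec, mul_eq_one_comm.mp hU, Matrix.one_mulVec]
  have htop : ∀ k, deg i < deg k → t k = 0 := by
    intro k hk
    rw [← htU]
    simp only [Matrix.mulVec, dotProduct] at hi ⊢
    refine Finset.sum_eq_zero fun l _ => ?_
    by_cases h : deg k = deg l
    · rw [hi l (h ▸ hk), mul_zero]
    · rw [hlayer k l h, zero_mul]
  rw [← hb₃ (deg i) (hpos i) i rfl hl _ ⟨t, mem_supportedBelow.mpr ⟨ht, htop⟩, rfl⟩]
  simp only [Matrix.mulVec, dotProduct]
  refine Finset.sum_congr rfl fun k _ => ?_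
  rw [degreeProj_apply]
  split_ifs with h
  · rfl
  · rw [Matrix.transpose_apply, hlayer k i h, zero_mul, mul_zero]

open Matrix in
/-- Every subspace of a graded coordinate space has a basis in block-echelon form after a
layer-preserving orthogonal change of coordinates. -/
lemma exists_echelon_basis (hmono : Monotone deg) (hpos : ∀ i, 1 ≤ deg i)
    (E : Submodule ℝ (Fin n → ℝ)) {p : ℕ} (hE : finrank ℝ E = p) :
    ∃ (U : Matrix (Fin n) (Fin n) ℝ) (w : Fin p → Fin n → ℝ),
      Uᵀ * U = 1 ∧ (∀ i k, deg i ≠ deg k → U i k = 0) ∧ LinearIndependent ℝ w ∧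
      (∀ j, w j ∈ E) ∧
      ∀ (i : Fin n) (j : Fin p) (c : ℕ), countLE deg (pivots E) (c - 1) ≤ j →
        (j : ℕ) < countLE deg (pivots E) c →
        (c < deg i → (Uᵀ *ᵥ w j) i = 0) ∧
        (c = deg i → (Uᵀ *ᵥ w j) i =
          if (i : ℕ) - countLE deg Finset.univ (deg i - 1) =
            (j : ℕ) - countLE deg (pivots E) (c - 1) then 1 else 0) ∧
        (deg i < c → (i : ℕ) - countLE deg Finset.univ (deg i - 1) <
          countEQ deg (pivots E) (deg i) → (Uᵀ *ᵥ w j) i = 0) := by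
  obtain ⟨U, hU, hlayer, hlead⟩ := exists_orthogonal_adapted hmono hpos E
  obtain ⟨π, hπ, hsurj⟩ := exists_enum_isLeading hmono hpos ((card_pivots E).trans hE)
  have htop : ∀ t ∈ E, ∀ i, (Uᵀ *ᵥ t) i ≠ 0 → ∃ j, i ≤ π j ∧ (Uᵀ *ᵥ t) (π j) ≠ 0 := by
    intro t ht i hi
    obtain ⟨l, hl, hlast⟩ := exists_last_ne_zero (Function.ne_iff.mpr ⟨i, hi⟩)
    have hll : IsLeading deg (pivots E) l := by
      by_contra h
      exact hl (hlead t ht l (fun k hk => hlast k (hmono.reflect_lt hk)) h)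
    obtain ⟨j, rfl⟩ := hsurj l hll
    exact ⟨j, not_lt.mp fun h => hi (hlast i h), hl⟩
  let Φ : E →ₗ[ℝ] (Fin p → ℝ) :=
    (LinearMap.pi fun j => LinearMap.proj (π j)) ∘ₗ Uᵀ.mulVecLin ∘ₗ E.subtype
  have hΦ : ∀ t j, Φ t j = (Uᵀ *ᵥ (t : Fin n → ℝ)) (π j) := fun _ _ => rfl
  have hinj : Function.Injective Φ := by
    rw [← LinearMap.ker_eq_bot, LinearMap.ker_eq_bot']
    intro t ht
    have hz : Uᵀ *ᵥ (t : Fin n → ℝ) = 0 := by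
      by_contra hne
      obtain ⟨i, hi⟩ := Function.ne_iff.mp hne
      obtain ⟨j, -, hj⟩ := htop t t.2 i hi
      exact hj (congrFun ht j)
    refine Subtype.ext ?_
    have := congrArg (U *ᵥ ·) hz
    simpa [Matrix.mulVec_mulVec, mul_eq_one_comm.mp hU] using this
  let e := LinearEquiv.ofInjectiveOfFinrankEq Φ hinj (by simp [hE])
  let w : Fin p → E := fun j => e.symm (Pi.single j 1)
  have hw : ∀ j l, (Uᵀ *ᵥ (w j : Fin n → ℝ)) (π l) = if l = j then 1 else 0 := by
    intro j l
    rw [← hΦ, ← Pi.single_apply]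
    exact congrFun (e.apply_symm_apply (Pi.single j 1)) l
  have hmonoLE : Monotone (countLE deg (pivots E)) := fun a b hab =>
    Finset.card_le_card (Finset.monotone_filter_right _ fun k _ hk => le_trans hk hab)
  refine ⟨U, fun j => w j, hU, hlayer, ?_, fun j => (w j).2, fun i j c hc₁ hc₂ => ?_⟩
  · have hcomp : Φ ∘ w = Pi.basisFun ℝ (Fin p) := by
      ext1 j
      rw [Pi.basisFun_apply]
      exact e.apply_symm_apply (Pi.single j 1)
    have h : LinearIndependent ℝ w :=
      .of_comp Φ (hcomp ▸ (Pi.basisFun ℝ (Fin p)).linearIndependent)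
    exact h.map' E.subtype (Submodule.ker_subtype E)
  have hdeg : deg (π j) = c := by
    obtain ⟨h₁, h₂, -⟩ := hπ j
    rcases lt_trichotomy (deg (π j)) c with h | h | h
    · have := hmonoLE (show deg (π j) ≤ c - 1 by omega)
      omega
    · exact h
    · have := hmonoLE (show c ≤ deg (π j) - 1 by omega)
      omega
  have hhigh : ∀ k, c < deg k → (Uᵀ *ᵥ (w j : Fin n → ℝ)) k = 0 := by
    intro k hk
    by_contra hne
    obtain ⟨l, hl, hl0⟩ := htop _ (w j).2 k hne
    rw [hw] at hl0
    have hlj : l = j := by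
      by_contra h
      exact hl0 (if_neg h)
    have := hmono hl
    rw [hlj] at this
    omega
  refine ⟨hhigh i, fun hci => ?_, fun hci hi => ?_⟩
  · by_cases hi : IsLeading deg (pivots E) i
    · obtain ⟨l, rfl⟩ := hsurj i hi
      rw [hw]
      obtain ⟨h₁, -, h₃⟩ := hπ l
      rw [h₃, ← hci]
      rw [← hci] at h₁
      refine if_congr ⟨fun h => by rw [h], fun h => Fin.ext ?_⟩ rfl rfl
      omega
    · rw [hlead _ (w j).2 i (fun k hk => hhigh k (hci ▸ hk)) hi, if_neg]
      have h := countLE_succ (deg := deg) (pivots E) (deg i - 1)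
      rw [Nat.sub_add_cancel (hpos i)] at h
      unfold IsLeading at hi
      rw [hci] at hc₁ hc₂ ⊢
      omega
  · obtain ⟨l, rfl⟩ := hsurj i hi
    rw [hw, if_neg]
    rintro rfl
    omega

end LinearAlgebra

namespace StratifiedGroup

variable (G : StratifiedGroup)

lemma neg_mul_self (x : G.Pt) : G.mul (-x) x = 0 := by
  simpa using G.mul_neg' (-x)

lemma differentiable_lTrans (x : G.Pt) : Differentiable ℝ (G.lTrans x) := by
  have h : ContDiff ℝ (⊤ : ℕ∞) (G.lTrans x) :=
    G.mul_smooth.comp (contDiff_const.prodMk contDiff_id)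
  exact h.differentiable (by simp)

lemma lTrans_neg_lTrans (x y : G.Pt) : G.lTrans (-x) (G.lTrans x y) = y := by
  simp only [lTrans]
  rw [← G.mul_assoc', neg_mul_self, G.zero_mul']

lemma lTrans_lTrans_neg (x y : G.Pt) : G.lTrans x (G.lTrans (-x) y) = y := by
  simpa using G.lTrans_neg_lTrans (-x) y

lemma fderiv_lTrans_comp_fderiv_lTrans_neg (x v : G.Pt) :
    fderiv ℝ (G.lTrans x) 0 (fderiv ℝ (G.lTrans (-x)) x v) = v := by
  have h₁ := (G.differentiable_lTrans (-x) x).hasFDerivAt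
  have h₂ := (G.differentiable_lTrans x (G.lTrans (-x) x)).hasFDerivAt.comp x h₁
  have h₃ : G.lTrans x ∘ G.lTrans (-x) = id := funext (G.lTrans_lTrans_neg x)
  have h₀ : G.lTrans (-x) x = 0 := G.neg_mul_self x
  rw [h₃, h₀] at h₂
  simpa using congrArg (· v) (h₂.unique (hasFDerivAt_id x))

lemma fderiv_lTrans_neg_comp_fderiv_lTrans (x v : G.Pt) :
    fderiv ℝ (G.lTrans (-x)) x (fderiv ℝ (G.lTrans x) 0 v) = v := by
  have hx : G.lTrans x 0 = x := G.mul_zero' x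
  have h₁ := (G.differentiable_lTrans x 0).hasFDerivAt
  have h₂ := (G.differentiable_lTrans (-x) (G.lTrans x 0)).hasFDerivAt.comp 0 h₁
  have h₃ : G.lTrans (-x) ∘ G.lTrans x = id := funext (G.lTrans_neg_lTrans x)
  rw [h₃, hx] at h₂
  simpa using congrArg (· v) (h₂.unique (hasFDerivAt_id 0))

/-- The differential at `x` of the left translation by `x⁻¹`. -/
noncomputable def translationEquiv (x : G.Pt) : G.Pt ≃ₗ[ℝ] G.Pt where
  __ := (fderiv ℝ (G.lTrans (-x)) x).toLinearMap
  invFun := fderiv ℝ (G.lTrans x) 0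
  left_inv := G.fderiv_lTrans_comp_fderiv_lTrans_neg x
  right_inv := G.fderiv_lTrans_neg_comp_fderiv_lTrans x

lemma translationEquiv_apply (x v : G.Pt) :
    G.translationEquiv x v = fderiv ℝ (G.lTrans (-x)) x v := rfl

lemma tangentAt_eq_map (S : Set G.Pt) (x : G.Pt) :
    G.tangentAt S x =
      (Submodule.span ℝ (tangentConeAt ℝ S x)).map (G.translationEquiv x).toLinearMap := by
  have hx : G.lTrans x 0 = x := G.mul_zero' x
  have h₀ : G.lTrans (-x) x = 0 := G.neg_mul_self x
  rw [tangentAt, Submodule.map_span]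
  congr 1
  refine Set.Subset.antisymm (fun v hv => ⟨fderiv ℝ (G.lTrans x) 0 v, ?_,
    G.fderiv_lTrans_neg_comp_fderiv_lTrans x v⟩) ?_
  · have h := (G.differentiable_lTrans x 0).hasFDerivAt.hasFDerivWithinAt.mapsTo_tangent_cone hv
    have himg : G.lTrans x '' G.shift x S = S := by
      change G.lTrans x '' (G.lTrans (-x) '' S) = S
      rw [Set.image_image]
      simp only [G.lTrans_lTrans_neg x, Set.image_id']
    rwa [himg, hx] at h
  · rintro _ ⟨v, hv, rfl⟩
    have h := (G.differentiable_lTrans (-x) x).hasFDerivAt.hasFDerivWithinAt.mapsTo_tangent_cone hv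
    rwa [h₀] at h

lemma pointDeg_eq_sum_pivots {p : ℕ} {S : Set G.Pt} {x : G.Pt}
    (h : finrank ℝ (G.tangentAt S x) = p) :
    G.pointDeg p S x = ∑ i ∈ pivots (G.tangentAt S x), G.deg i := by
  refine IsGreatest.csSup_eq ⟨⟨_, (card_pivots _).trans h,
    fun v hv => eq_zero_of_pivots hv, rfl⟩, ?_⟩
  rintro _ ⟨A, hA, hinj, rfl⟩
  exact sum_deg_le_sum_pivots G.deg_mono _ (hA.trans h.symm) hinj

lemma cumsum_countEQ (A : Finset (Fin G.n)) (c : ℕ) :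
    cumsum (countEQ G.deg A) c = countLE G.deg A c := by
  induction c with
  | zero =>
    have h : ∀ i, G.deg i ≠ 0 := fun i => Nat.one_le_iff_ne_zero.mp (G.deg_pos i)
    simp [cumsum, countLE, h]
  | succ c ih =>
    rw [countLE_succ, ← ih, cumsum, cumsum, Finset.sum_Icc_succ_top (by omega)]

end StratifiedGroup

/-- **Block-echelon tangent basis (Lemma 2.5).**
Let `Σ` be a `p`-dimensional Lipschitz submanifold of a stratified group `G` and let
`x ∈ Σ ∖ Σ_*`.  Then there are a graded basis of the Lie algebra (encoded by an
orthogonal layer-preserving change of basis matrix `U`: its columns are the new graded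
basis at the identity), a basis `v_1, …, v_p` of `T_xΣ` and integers `0 ≤ α_k ≤ n_k`
with `α_1 + ⋯ + α_ι = p`, such that the coefficient matrix `C` defined by
`v_j = ∑_i C_{ij} X_i(x)` has the block-echelon form of the lemma:  writing `k = deg i`
for the layer of the row `i`, `s = i - m_{k-1}` for its position inside the layer and
`c` for the group of the column `j` (i.e. `μ_{c-1} ≤ j < μ_c` with `μ_c = α_1 + ⋯ + α_c`),
one has `C i j = 0` if `c < k`; `C i j = δ_{s, j - μ_{c-1}}` if `c = k` (the identity
block `Id_{α_k}` on top, zeros below); and `C i j = 0` if `c > k` and `s < α_k` (zeros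
above, arbitrary entries below).  Moreover `d_Σ(x) = ∑_k k·α_k`. -/
theorem statement9 (G : StratifiedGroup) (p : ℕ) (S : Set G.Pt)
    (hS : IsLipschitzSubmanifold G.n p S) (x : G.Pt) (hx : x ∈ S)
    (hx' : x ∉ singularSet G.n p S) :
    ∃ (U : Matrix (Fin G.n) (Fin G.n) ℝ) (v : Fin p → G.Pt) (α : ℕ → ℕ),
      U.transpose * U = 1 ∧
      (∀ i k : Fin G.n, G.deg i ≠ G.deg k → U i k = 0) ∧
      LinearIndependent ℝ v ∧
      Submodule.span ℝ (Set.range v) = Submodule.span ℝ (tangentConeAt ℝ S x) ∧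
      (∀ k, 1 ≤ k → k ≤ G.ι → α k ≤ G.nLayer k) ∧
      α 0 = 0 ∧ (∀ k, G.ι < k → α k = 0) ∧
      (∑ k ∈ Finset.Icc 1 G.ι, α k) = p ∧
      (∀ (i : Fin G.n) (j : Fin p) (c : ℕ), 1 ≤ c → c ≤ G.ι →
        cumsum α (c - 1) ≤ (j : ℕ) → (j : ℕ) < cumsum α c →
        (c < G.deg i → Cmat G U v x i j = 0) ∧
        (c = G.deg i →
          Cmat G U v x i j =
            (if (i : ℕ) - G.mVal (G.deg i - 1) = (j : ℕ) - cumsum α (c - 1)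
              then 1 else 0)) ∧
        (G.deg i < c → (i : ℕ) - G.mVal (G.deg i - 1) < α (G.deg i) →
          Cmat G U v x i j = 0)) ∧
      G.pointDeg p S x = ∑ k ∈ Finset.Icc 1 G.ι, k * α k := by
  set E := G.tangentAt S x with hEdef
  obtain ⟨T, hTp, hT⟩ : ∃ T : Submodule ℝ G.Pt, finrank ℝ T = p ∧
      tangentConeAt ℝ S x = (T : Set G.Pt) := by
    by_contra h
    exact hx' ⟨hx, h⟩
  have hspan : Submodule.span ℝ (tangentConeAt ℝ S x) = T := by rw [hT, Submodule.span_eq]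
  have hET : E = T.map (G.translationEquiv x).toLinearMap := by
    rw [hEdef, G.tangentAt_eq_map, hspan]
  have hEp : finrank ℝ E = p := by
    rw [hET, ← hTp]
    exact (G.translationEquiv x).finrank_map_eq T
  obtain ⟨U, w, hU, hlayer, hli, hwE, hech⟩ :=
    exists_echelon_basis G.deg_mono G.deg_pos E hEp
  have hv : LinearIndependent ℝ fun j => (G.translationEquiv x).symm (w j) :=
    hli.map' (G.translationEquiv x).symm.toLinearMap (LinearEquiv.ker _)
  have hvT : ∀ j, (G.translationEquiv x).symm (w j) ∈ T := by
    intro j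
    have h := hwE j
    rw [hET] at h
    obtain ⟨t, ht, htw⟩ := h
    rw [← htw]
    simpa using ht
  have hmaps : ∀ i ∈ pivots E, G.deg i ∈ Finset.Icc 1 G.ι := fun i _ =>
    Finset.mem_Icc.mpr ⟨G.deg_pos i, G.deg_le i⟩
  have hC : ∀ i j, Cmat G U (fun j => (G.translationEquiv x).symm (w j)) x i j =
      (U.transpose.mulVec (w j)) i := by
    intro i j
    simp only [Cmat, ← G.translationEquiv_apply, LinearEquiv.apply_symm_apply]
    rfl
  refine ⟨U, fun j => (G.translationEquiv x).symm (w j), countEQ G.deg (pivots E), hU, hlayer,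
    hv, ?_, fun k _ _ => countEQ_le_univ _ k, ?_, fun k hk => ?_, ?_, ?_, ?_⟩
  · rw [hspan]
    refine Submodule.eq_of_le_of_finrank_eq (Submodule.span_le.mpr ?_) ?_
    · rintro _ ⟨j, rfl⟩
      exact hvT j
    · rw [finrank_span_eq_card hv, hTp, Fintype.card_fin]
  · have h : ∀ i, G.deg i ≠ 0 := fun i => Nat.one_le_iff_ne_zero.mp (G.deg_pos i)
    simp [countEQ, h]
  · have h : ∀ i, G.deg i ≠ k := fun i => ((G.deg_le i).trans_lt hk).ne
    simp [countEQ, h]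
  · rw [← hEp, ← card_pivots]
    exact (Finset.card_eq_sum_card_fiberwise hmaps).symm
  · intro i j c _ _ hc₁ hc₂
    rw [G.cumsum_countEQ] at hc₁ hc₂ ⊢
    rw [hC]
    exact hech i j c hc₁ hc₂
  · rw [G.pointDeg_eq_sum_pivots hEp, ← Finset.sum_fiberwise_of_maps_to hmaps]
    refine Finset.sum_congr rfl fun k _ => ?_
    rw [Finset.sum_congr rfl fun i hi => (Finset.mem_filter.mp hi).2, Finset.sum_const,
      smul_eq_mul, mul_comm]
    rfl
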